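/- Let θ : ℂ^n → ℂ^n be the map sending z = (z_1,…,z_n) to (p_z(z_1),…,p_z(z_n)), where p_z(z) = ∫_0^z (w−z_1)⋯(w−z_n) dw. If the entries z_1,…,z_n of a point z ∈ ℂ^n are distinct and nonzero, then θ is a local homeomorphism at z: there exist open neighborhoods U of z and V of θ(z) in ℂ^n such that θ restricts to a homeomorphism from U onto V. -/

import Mathlib

open Polynomial in
/-- The coefficients of `∏ (X - z i)` depend smoothly on the roots. -/
theorem contDiff_coeff_prod_X_sub_C {ι : Type*} [Fintype ι] (s : Finset ι) (m : ℕ) :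
    ContDiff ℂ 1 fun z : ι → ℂ => (∏ i ∈ s, (X - C (z i))).coeff m := by
  classical
  induction s using Finset.induction_on generalizing m with
  | empty => simpa using contDiff_const
  | insert a s ha ih =>
    simp only [Finset.prod_insert ha, sub_mul, coeff_sub, coeff_C_mul]
    refine ContDiff.sub ?_ ((contDiff_apply ℂ ℂ a).mul (ih m))
    cases m with
    | zero => simpa using contDiff_const
    | succ k => simpa only [coeff_X_mul] using ih k

open Polynomial in
/-- The value at `w` of `∏ (X - z i)` in terms of its coefficients. -/
theorem eval_prod_X_sub_C_eq_sum {n : ℕ} (z : Fin n → ℂ) (w : ℂ) :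
    ∑ m ∈ Finset.range (n + 1), (∏ i, (X - C (z i))).coeff m * w ^ m = ∏ i, (w - z i) := by
  have h := eval_eq_sum_range (p := ∏ i, (X - C (z i))) w
  rw [natDegree_finsetProd_X_sub_C_eq_card, Finset.card_univ, Fintype.card_fin] at h
  rw [← h, eval_prod]
  simp

open Polynomial in
/-- The monic leading coefficient of `∏ (X - z i)`. -/
theorem coeff_card_prod_X_sub_C {n : ℕ} (z : Fin n → ℂ) :
    (∏ i, (X - C (z i))).coeff n = 1 := by
  have h := (monic_prod_X_sub_C z Finset.univ).coeff_natDegree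
  rwa [natDegree_finsetProd_X_sub_C_eq_card, Finset.card_univ, Fintype.card_fin] at h

open Polynomial in
/-- The antiderivative of `∏ (X - z i)` without constant term, in terms of coefficients. -/
theorem derivative_sum_monomial_coeff_prod {n : ℕ} (z : Fin n → ℂ) :
    derivative (∑ m ∈ Finset.range (n + 1),
      monomial (m + 1) ((∏ i, (X - C (z i))).coeff m / ((m : ℂ) + 1))) = ∏ i, (X - C (z i)) := by
  have hq := as_sum_range (∏ i, (X - C (z i)))
  rw [natDegree_finsetProd_X_sub_C_eq_card, Finset.card_univ, Fintype.card_fin] at hq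
  conv_rhs => rw [hq]
  rw [derivative_sum]
  refine Finset.sum_congr rfl fun m _ => ?_
  have : (m : ℂ) + 1 ≠ 0 := by exact_mod_cast m.succ_ne_zero
  rw [derivative_monomial, Nat.add_sub_cancel]
  push_cast
  rw [div_mul_cancel₀ _ this]

open Polynomial in
/-- A polynomial `∑ d m X ^ (m + 1) / (m + 1)` of degree at most `n` vanishing at `n` distinct
nonzero points is zero. -/
theorem eq_zero_of_sum_div_mul_pow_eq_zero {n : ℕ} {z : Fin n → ℂ} (hinj : Function.Injective z)
    (hz : ∀ i, z i ≠ 0) {d : ℕ → ℂ}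
    (h : ∀ j, ∑ m ∈ Finset.range n, d m / (m + 1) * z j ^ (m + 1) = 0) {m : ℕ} (hm : m < n) :
    d m = 0 := by
  classical
  set P : ℂ[X] := ∑ m ∈ Finset.range n, monomial m (d m / (m + 1)) with hP
  have hdeg : P.degree < (Finset.univ.image z).card := by
    rw [Finset.card_image_of_injective _ hinj, Finset.card_univ, Fintype.card_fin]
    refine (degree_sum_le _ _).trans_lt ((Finset.sup_lt_iff (WithBot.bot_lt_coe n)).2 ?_)
    intro k hk
    exact (degree_monomial_le _ _).trans_lt (Nat.cast_lt.2 (Finset.mem_range.1 hk))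
  have hP0 : P = 0 := by
    refine eq_zero_of_degree_lt_of_eval_finset_eq_zero _ hdeg fun x hx => ?_
    obtain ⟨j, -, rfl⟩ := Finset.mem_image.1 hx
    refine (mul_eq_zero.1 ?_).resolve_right (hz j)
    rw [← h j, hP, eval_finsetSum, Finset.sum_mul]
    refine Finset.sum_congr rfl fun k _ => ?_
    rw [eval_monomial, pow_succ, mul_assoc]
  have hc : P.coeff m = d m / (m + 1) := by
    rw [hP, finsetSum_coeff]
    simp [coeff_monomial, hm]
  rw [hP0, coeff_zero] at hc
  have : (m : ℂ) + 1 ≠ 0 := by exact_mod_cast m.succ_ne_zero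
  exact (div_eq_zero_iff.1 hc.symm).resolve_right this

/-- A direction along which `∏ (w - z i)` is stationary for every `w` is zero when the `z i` are
distinct. -/
theorem eq_zero_of_hasDerivAt_prod_sub_eq_zero {n : ℕ} {z v : Fin n → ℂ}
    (hinj : Function.Injective z)
    (h : ∀ w : ℂ, HasDerivAt (fun t : ℂ => ∏ i, (w - (z i + t * v i))) 0 0) : v = 0 := by
  funext j
  have hd : HasDerivAt (fun t : ℂ => ∏ i, (z j - (z i + t * v i)))
      (∑ i, (∏ k ∈ Finset.univ.erase i, (z j - (z k + 0 * v k))) • (-(1 * v i))) 0 :=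
    HasDerivAt.fun_finsetProd fun i _ =>
      ((((hasDerivAt_id (0 : ℂ)).mul_const (v i)).const_add (z i)).const_sub (z j))
  have hs := hd.unique (h (z j))
  rw [Finset.sum_eq_single j] at hs
  · have hne : ∏ k ∈ Finset.univ.erase j, (z j - (z k + 0 * v k)) ≠ 0 := by
      refine Finset.prod_ne_zero_iff.2 fun k hk => ?_
      rw [zero_mul, add_zero, sub_ne_zero]
      exact fun e => Finset.ne_of_mem_erase hk (hinj e).symm
    simpa [hne] using (smul_eq_zero.1 hs).resolve_left hne
  · intro i _ hi
    rw [Finset.prod_eq_zero (Finset.mem_erase.2 ⟨hi.symm, Finset.mem_univ j⟩) (by simp), zero_smul]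
  · simp

/-- If the entries of `z ∈ ℂ^n` are distinct and nonzero, then the map
`θ : ℂ^n → ℂ^n` sending `z` to `(p_z(z_1), …, p_z(z_n))`, where `p_z` is the unique
polynomial with derivative `(w - z_1) ⋯ (w - z_n)` and no constant term, is a local
homeomorphism at `z`. -/
theorem theta_local_homeo_at_distinct_nonzero
    (n : ℕ)
    (θ : (Fin n → ℂ) → Fin n → ℂ)
    (hθ : ∀ z : Fin n → ℂ, ∀ p : Polynomial ℂ,
      Polynomial.derivative p = ∏ i, (Polynomial.X - Polynomial.C (z i)) →
      p.coeff 0 = 0 → ∀ j, θ z j = p.eval (z j))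
    (z : Fin n → ℂ) (hinj : Function.Injective z) (hz : ∀ i, z i ≠ 0) :
    ∃ U V : Set (Fin n → ℂ), IsOpen U ∧ IsOpen V ∧ z ∈ U ∧ θ z ∈ V ∧
      ∃ h : U ≃ₜ V, ∀ x : U, (h x : Fin n → ℂ) = θ x := by
  classical
  set c : ℕ → (Fin n → ℂ) → ℂ :=
    fun m x => (∏ i, (Polynomial.X - Polynomial.C (x i))).coeff m with hc
  have hcs (m : ℕ) : ContDiff ℂ 1 (c m) := contDiff_coeff_prod_X_sub_C Finset.univ m
  have hθc : θ = fun x j => ∑ m ∈ Finset.range (n + 1), c m x / (m + 1) * x j ^ (m + 1) := by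
    funext x j
    rw [hθ x _ (derivative_sum_monomial_coeff_prod x)
      (by simp [Polynomial.finsetSum_coeff, Polynomial.coeff_monomial]) j,
      Polynomial.eval_finsetSum]
    simp only [Polynomial.eval_monomial, hc]
  have hs : ContDiff ℂ 1 θ := by
    rw [hθc, contDiff_pi]
    exact fun j => ContDiff.sum fun m _ =>
      ((hcs m).div_const _).mul ((contDiff_apply ℂ ℂ j).pow _)
  have hker : ∀ v, fderiv ℂ θ z v = 0 → v = 0 := by
    intro v hv
    have hline : HasDerivAt (fun t : ℂ => z + t • v) v 0 := by
      simpa using ((hasDerivAt_id (0 : ℂ)).smul_const v).const_add z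
    have hz0 : z + (0 : ℂ) • v = z := by simp
    have along {F : Type} [NormedAddCommGroup F] [NormedSpace ℂ F] {f : (Fin n → ℂ) → F}
        (hf : ContDiff ℂ 1 f) : HasDerivAt (fun t : ℂ => f (z + t • v)) (fderiv ℂ f z v) 0 := by
      refine HasFDerivAt.comp_hasDerivAt (0 : ℂ) ?_ hline
      rw [hz0]
      exact (hf.differentiable one_ne_zero z).hasFDerivAt
    set d : ℕ → ℂ := fun m => fderiv ℂ (c m) z v with hd
    have hdn : d n = 0 := by
      have : c n = fun _ => 1 := funext coeff_card_prod_X_sub_C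
      simp [hd, this]
    have hdm (m : ℕ) (hm : m < n) : d m = 0 := by
      refine eq_zero_of_sum_div_mul_pow_eq_zero hinj hz (fun j => ?_) hm
      have h1 := hasDerivAt_pi.1 (along hs) j
      rw [hv] at h1
      have h2 : HasDerivAt (fun t : ℂ => θ (z + t • v) j)
          (∑ m ∈ Finset.range (n + 1), (d m / (m + 1) * z j ^ (m + 1) +
            c m z / (m + 1) * (((m + 1 : ℕ) : ℂ) * z j ^ m * v j))) 0 := by
        simp only [hθc]
        refine HasDerivAt.fun_sum fun m _ => ?_
        simpa only [hz0, Nat.add_sub_cancel] using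
          ((along (hcs m)).div_const ((m : ℂ) + 1)).fun_mul
            ((hasDerivAt_pi.1 hline j).fun_pow (m + 1))
      have h3 := h2.unique h1
      have h4 : ∑ m ∈ Finset.range (n + 1),
          c m z / (m + 1) * (((m + 1 : ℕ) : ℂ) * z j ^ m * v j) = 0 := by
        have h5 := eval_prod_X_sub_C_eq_sum z (z j)
        rw [Finset.prod_eq_zero (f := fun i => z j - z i) (Finset.mem_univ j) (sub_self _)] at h5
        rw [← zero_mul (v j), ← h5, Finset.sum_mul]
        refine Finset.sum_congr rfl fun m _ => ?_
        have : (m : ℂ) + 1 ≠ 0 := by exact_mod_cast m.succ_ne_zero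
        push_cast
        field_simp
        simp only [hc]
        ring
      rw [Finset.sum_add_distrib, h4, add_zero, Finset.sum_range_succ, hdn] at h3
      simpa using h3
    refine eq_zero_of_hasDerivAt_prod_sub_eq_zero hinj fun w => ?_
    have h6 : HasDerivAt (fun t : ℂ => ∑ m ∈ Finset.range (n + 1), c m (z + t • v) * w ^ m)
        (∑ m ∈ Finset.range (n + 1), d m * w ^ m) 0 :=
      HasDerivAt.fun_sum fun m _ => (along (hcs m)).mul_const _
    rw [Finset.sum_eq_zero fun m hm => ?_] at h6
    · simpa only [hc, eval_prod_X_sub_C_eq_sum, Pi.add_apply, Pi.smul_apply, smul_eq_mul] using h6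
    · rcases Nat.lt_succ_iff_lt_or_eq.1 (Finset.mem_range.1 hm) with h | rfl
      · rw [hdm m h, zero_mul]
      · rw [hdn, zero_mul]
  let e : (Fin n → ℂ) ≃L[ℂ] (Fin n → ℂ) :=
    (LinearEquiv.ofInjectiveEndo (fderiv ℂ θ z : (Fin n → ℂ) →ₗ[ℂ] (Fin n → ℂ))
      ((injective_iff_map_eq_zero _).2 hker)).toContinuousLinearEquiv
  have he : HasFDerivAt θ (e : (Fin n → ℂ) →L[ℂ] (Fin n → ℂ)) z :=
    (hs.differentiable one_ne_zero z).hasFDerivAt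
  let g := hs.contDiffAt.toOpenPartialHomeomorph θ he one_ne_zero
  have hzg : z ∈ g.source := hs.contDiffAt.mem_toOpenPartialHomeomorph_source he one_ne_zero
  exact ⟨g.source, g.target, g.open_source, g.open_target, hzg, g.map_source hzg,
    g.toHomeomorphSourceTarget, fun _ => rfl⟩
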